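/- The supremum defining v^α is attained: there exists a measurable n-partition (A*_1,…,A*_n) of C such that min_{1≤i≤n} μ_i(A*_i)/α_i = v^α. -/

import Mathlib

open MeasureTheory

/-- A measurable `n`-partition of the whole space `C`. -/
def IsMPartition {C : Type*} [MeasurableSpace C] {n : ℕ} (A : Fin n → Set C) : Prop :=
  (∀ i, MeasurableSet (A i)) ∧ Pairwise (Function.onFun Disjoint A) ∧ (⋃ i, A i) = Set.univ

/-- The `α`-optimal value `v^α`. -/
noncomputable def vopt {C : Type*} [MeasurableSpace C] {n : ℕ} (μ : Fin n → Measure C)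
    (α : Fin n → ℝ) : ℝ :=
  sSup {r : ℝ | ∃ A : Fin n → Set C, IsMPartition A ∧ r = ⨅ i, (μ i (A i)).toReal / α i}

section abstractH
variable {H : Type*} [NormedAddCommGroup H] [InnerProductSpace ℝ H] [CompleteSpace H] {n : ℕ}

/-- Tuples of vectors viewed in the weak dual. -/
noncomputable def wkMap (Φ : Fin n → H) : Fin n → WeakDual ℝ H :=
  fun i => StrongDual.toWeakDual (InnerProductSpace.toDual ℝ H (Φ i))

lemma wkMap_apply (Φ : Fin n → H) (i : Fin n) (g : H) : wkMap Φ i g = inner ℝ (Φ i) g := by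
  simp [wkMap]

lemma wkMap_surj (Λ : Fin n → WeakDual ℝ H) : ∃ Φ : Fin n → H, wkMap Φ = Λ := by
  refine ⟨fun i => (InnerProductSpace.toDual ℝ H).symm (WeakDual.toStrongDual (Λ i)), ?_⟩
  funext i
  simp [wkMap]

lemma wkMap_inj {Φ Ψ : Fin n → H} (h : wkMap Φ = wkMap Ψ) : Φ = Ψ := by
  funext i
  apply ext_inner_right ℝ
  intro g
  rw [← wkMap_apply, ← wkMap_apply, h]

lemma wkMap_add (Φ Ψ : Fin n → H) : wkMap (Φ + Ψ) = wkMap Φ + wkMap Ψ := by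
  funext i
  simp [wkMap]

lemma wkMap_smul (c : ℝ) (Φ : Fin n → H) : wkMap (c • Φ) = c • wkMap Φ := by
  funext i
  simp [wkMap]

lemma wk_compact (Z : Set (Fin n → WeakDual ℝ H)) (hZ : IsClosed Z) (R : ℝ)
    (hR : ∀ Φ, wkMap Φ ∈ Z → ∀ i, ‖Φ i‖ ≤ R) : IsCompact Z := by
  have h1 : IsCompact (Set.univ.pi fun _ : Fin n =>
      (WeakDual.toStrongDual ⁻¹' Metric.closedBall (0 : StrongDual ℝ H) R)) :=
    isCompact_univ_pi fun _ => WeakDual.isCompact_closedBall _ _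
  refine h1.of_isClosed_subset hZ ?_
  intro Λ hΛ
  obtain ⟨Φ, rfl⟩ := wkMap_surj Λ
  intro i _
  have := hR Φ hΛ i
  simpa [wkMap] using this

lemma wk_extreme (Z : Set (Fin n → WeakDual ℝ H)) (hZ : IsCompact Z) (hne : Z.Nonempty) :
    ∃ Φ, wkMap Φ ∈ Z ∧ ∀ Ψ, wkMap (Φ + Ψ) ∈ Z → wkMap (Φ + (-1 : ℝ) • Ψ) ∈ Z → Ψ = 0 := by
  have : LocallyConvexSpace ℝ (WeakDual ℝ H) :=
    inferInstanceAs (LocallyConvexSpace ℝ (WeakBilin (topDualPairing ℝ H)))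
  obtain ⟨Λ, hΛ⟩ := hZ.extremePoints_nonempty hne
  obtain ⟨Φ, rfl⟩ := wkMap_surj Λ
  rw [mem_extremePoints_iff_left] at hΛ
  refine ⟨Φ, hΛ.1, fun Ψ h1 h2 => ?_⟩
  have := hΛ.2 _ h1 _ h2 ⟨1/2, 1/2, by norm_num, by norm_num, by norm_num, by
    rw [← wkMap_smul, ← wkMap_smul, ← wkMap_add]
    congr 1
    module⟩
  have := wkMap_inj this
  simpa using this

end abstractH

section L2
variable {C : Type*} [MeasurableSpace C] {ν : Measure C} [IsFiniteMeasure ν] {n : ℕ}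

/-- indicator in L2 -/
noncomputable def indL (ν : Measure C) [IsFiniteMeasure ν] {B : Set C} (hB : MeasurableSet B) :
    Lp ℝ 2 ν := indicatorConstLp 2 hB (measure_ne_top ν B) (1 : ℝ)

lemma inner_indL (f : Lp ℝ 2 ν) {B : Set C} (hB : MeasurableSet B) :
    inner ℝ f (indL ν hB) = ∫ x in B, f x ∂ν := by
  rw [real_inner_comm]; exact L2.inner_indicatorConstLp_one hB _ f

/-- The feasible set of fractional allocations. -/
def feasZ (ν : Measure C) [IsFiniteMeasure ν] (n : ℕ) : Set (Fin n → WeakDual ℝ (Lp ℝ 2 ν)) :=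
  {Λ | ∀ (B : Set C) (hB : MeasurableSet B), (∀ i, 0 ≤ Λ i (indL ν hB)) ∧
    ∑ i, Λ i (indL ν hB) = ν.real B}

lemma cont_eval {H : Type*} [NormedAddCommGroup H] [InnerProductSpace ℝ H] (i : Fin n) (g : H) :
    Continuous fun Λ : Fin n → WeakDual ℝ H => Λ i g :=
  (WeakDual.eval_continuous g).comp (continuous_apply i)

lemma feasZ_closed : IsClosed (feasZ ν n) := by
  unfold feasZ
  simp only [Set.ofPred_forall, Set.ofPred_and]
  refine isClosed_iInter fun B => isClosed_iInter fun hB => IsClosed.inter ?_ ?_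
  · exact isClosed_iInter fun i => isClosed_le continuous_const (cont_eval i _)
  · exact isClosed_eq (continuous_finsetSum _ fun i _ => cont_eval i _) continuous_const

lemma L2_int (f : Lp ℝ 2 ν) : Integrable f ν := (Lp.memLp f).integrable (by norm_num)

lemma feas_iff (Φ : Fin n → Lp ℝ 2 ν) :
    wkMap Φ ∈ feasZ ν n ↔ (∀ i, ∀ᵐ x ∂ν, 0 ≤ Φ i x) ∧ ∀ᵐ x ∂ν, ∑ i, Φ i x = 1 := by
  simp only [feasZ, Set.mem_ofPred_eq, wkMap_apply, inner_indL]
  constructor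
  · intro h
    constructor
    · intro i
      exact ae_nonneg_of_forall_setIntegral_nonneg (L2_int _) fun s hs _ => (h s hs).1 i
    · refine Integrable.ae_eq_of_forall_setIntegral_eq (fun x => ∑ i, Φ i x) (fun _ => (1:ℝ))
        (integrable_finsetSum _ fun i _ => L2_int _) (integrable_const _) fun s hs _ => ?_
      rw [integral_finsetSum _ fun i _ => (L2_int _).integrableOn, (h s hs).2]
      simp
  · rintro ⟨h1, h2⟩ B hB
    refine ⟨fun i => integral_nonneg_of_ae (ae_restrict_of_ae (h1 i)), ?_⟩
    rw [← integral_finsetSum _ fun i _ => (L2_int _).integrableOn,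
      integral_congr_ae (ae_restrict_of_ae h2)]
    simp

lemma feas_le_one (Φ : Fin n → Lp ℝ 2 ν) (h : wkMap Φ ∈ feasZ ν n) (i : Fin n) :
    ∀ᵐ x ∂ν, Φ i x ≤ 1 := by
  obtain ⟨h1, h2⟩ := (feas_iff Φ).1 h
  filter_upwards [ae_all_iff.2 h1, h2] with x hx hs
  rw [← hs]
  exact Finset.single_le_sum (f := fun i => Φ i x) (fun j _ => hx j) (Finset.mem_univ i)

lemma feas_bdd : ∃ R : ℝ, ∀ Φ : Fin n → Lp ℝ 2 ν, wkMap Φ ∈ feasZ ν n → ∀ i, ‖Φ i‖ ≤ R := by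
  refine ⟨‖indL ν MeasurableSet.univ‖, fun Φ h i => ?_⟩
  apply Lp.norm_le_norm_of_ae_le
  have h3 : indL ν MeasurableSet.univ =ᵐ[ν] Set.indicator Set.univ fun _ => (1:ℝ) :=
    indicatorConstLp_coeFn
  filter_upwards [((feas_iff Φ).1 h).1 i, feas_le_one Φ h i, h3] with x h1 h2 h3
  rw [h3]
  simp [abs_of_nonneg h1, h2]

lemma feas_compact (Z : Set (Fin n → WeakDual ℝ (Lp ℝ 2 ν))) (hZ : IsClosed Z) :
    IsCompact (feasZ ν n ∩ Z) := by
  obtain ⟨R, hR⟩ := feas_bdd (ν := ν) (n := n)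
  exact (wk_compact _ feasZ_closed R hR).inter_right hZ

/-- Atoms of a measure. -/
def IsAtm (ν : Measure C) (B : Set C) : Prop :=
  MeasurableSet B ∧ ν B ≠ 0 ∧ ∀ T ⊆ B, MeasurableSet T → ν T = 0 ∨ ν (B \ T) = 0

lemma split3 {D : Set C} (hD : MeasurableSet D) (h0 : ν D ≠ 0) (hna : ∀ B ⊆ D, ¬ IsAtm ν B) :
    ∃ E : Fin 3 → Set C, (∀ k, MeasurableSet (E k)) ∧ (∀ k, E k ⊆ D) ∧ (∀ k, ν (E k) ≠ 0) ∧
      Pairwise (Function.onFun Disjoint E) := by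
  have key : ∀ D' ⊆ D, MeasurableSet D' → ν D' ≠ 0 →
      ∃ T ⊆ D', MeasurableSet T ∧ ν T ≠ 0 ∧ ν (D' \ T) ≠ 0 := by
    intro D' hs hm h0
    by_contra hcon
    push Not at hcon
    refine hna D' hs ⟨hm, h0, fun T hT hTm => ?_⟩
    by_contra h
    push Not at h
    exact h.2 (hcon T hT hTm h.1)
  obtain ⟨T, hTD, hTm, hT0, hT1⟩ := key D le_rfl hD h0
  obtain ⟨S, hSD, hSm, hS0, hS1⟩ := key (D \ T) Set.sdiff_subset (hD.diff hTm) hT1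
  refine ⟨![T, S, (D \ T) \ S], ?_, ?_, ?_, ?_⟩
  · intro k; fin_cases k
    · exact hTm
    · exact hSm
    · exact (hD.diff hTm).diff hSm
  · intro k; fin_cases k
    · exact hTD
    · exact hSD.trans Set.sdiff_subset
    · exact Set.sdiff_subset.trans Set.sdiff_subset
  · intro k; fin_cases k <;> simp [*]
  · have a : Disjoint T S := (Set.disjoint_sdiff_right (s := T) (t := D)).mono_right hSD
    have b : Disjoint T ((D \ T) \ S) :=
      (Set.disjoint_sdiff_right (s := T) (t := D)).mono_right Set.sdiff_subset
    have c : Disjoint S ((D \ T) \ S) := Set.disjoint_sdiff_right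
    intro k l hkl
    fin_cases k <;> fin_cases l <;> simp_all [Function.onFun, disjoint_comm]

lemma lin3 (u v : Fin 3 → ℝ) (δ : ℝ) (hδ : 0 < δ) :
    ∃ a : Fin 3 → ℝ, a ≠ 0 ∧ (∀ k, |a k| ≤ δ) ∧ ∑ k, a k * u k = 0 ∧ ∑ k, a k * v k = 0 := by
  let F : (Fin 3 → ℝ) →ₗ[ℝ] (Fin 2 → ℝ) := Matrix.toLin' (Matrix.of ![u, v])
  have hF : LinearMap.ker F ≠ ⊥ := F.ker_ne_bot_of_finrank_lt (by simp)
  obtain ⟨b, hb, hb0⟩ := Submodule.exists_mem_ne_zero_of_ne_bot hF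
  have h0 := congrFun (LinearMap.mem_ker.1 hb) 0
  have h1 := congrFun (LinearMap.mem_ker.1 hb) 1
  simp [F, Matrix.mulVec, dotProduct, Fin.sum_univ_three] at h0 h1
  have hn : 0 < ‖b‖ := norm_pos_iff.2 hb0
  refine ⟨(δ / ‖b‖) • b, ?_, ?_, ?_, ?_⟩
  · exact smul_ne_zero (by positivity) hb0
  · intro k
    have := norm_le_pi_norm b k
    rw [Real.norm_eq_abs] at this
    simp only [Pi.smul_apply, smul_eq_mul, abs_mul, abs_of_pos (div_pos hδ hn)]
    rw [div_mul_eq_mul_div, div_le_iff₀ hn]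
    gcongr
  · simp [Fin.sum_univ_three]; linear_combination (δ / ‖b‖) * h0
  · simp [Fin.sum_univ_three]; linear_combination (δ / ‖b‖) * h1

lemma inter_atm_null {D B : Set C} (hD : MeasurableSet D) (hna : ∀ B ⊆ D, ¬ IsAtm ν B)
    (hB : IsAtm ν B) : ν (D ∩ B) = 0 := by
  by_contra h
  refine hna (D ∩ B) Set.inter_subset_left ⟨hD.inter hB.1, h, fun T hT hTm => ?_⟩
  rcases hB.2.2 T (hT.trans Set.inter_subset_right) hTm with h1 | h1
  · exact Or.inl h1
  · exact Or.inr (measure_mono_null (Set.sdiff_subset_sdiff_left Set.inter_subset_right) h1)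

/-- A nonzero bounded perturbation supported on an atomless set. -/
lemma exists_pert {D : Set C} (hD : MeasurableSet D) (h0 : ν D ≠ 0)
    (hna : ∀ B ⊆ D, ¬ IsAtm ν B) (f g : Lp ℝ 2 ν) (δ : ℝ) (hδ : 0 < δ) :
    ∃ h : Lp ℝ 2 ν, h ≠ 0 ∧ inner ℝ h f = 0 ∧ inner ℝ h g = 0 ∧
      (∀ B (hB : IsAtm ν B), inner ℝ h (indL ν hB.1) = 0) ∧
      ∀ᵐ x ∂ν, |h x| ≤ δ ∧ (x ∉ D → h x = 0) := by
  obtain ⟨E, hEm, hED, hE0, hEd⟩ := split3 hD h0 hna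
  obtain ⟨a, ha0, haδ, hu, hv⟩ := lin3 (fun k => ∫ x in E k, f x ∂ν) (fun k => ∫ x in E k, g x ∂ν)
    δ hδ
  have hii : ∀ k (B : Set C) (hB : MeasurableSet B),
      inner ℝ (indL ν (hEm k)) (indL ν hB) = ν.real (E k ∩ B) := by
    intro k B hB
    rw [inner_indL]
    have h3 : indL ν (hEm k) =ᵐ[ν] Set.indicator (E k) fun _ => (1:ℝ) := indicatorConstLp_coeFn
    rw [integral_congr_ae (ae_restrict_of_ae h3), setIntegral_indicator (hEm k)]
    simp [Set.inter_comm]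
  refine ⟨∑ k, a k • indL ν (hEm k), ?_, ?_, ?_, ?_, ?_⟩
  · intro hz
    apply ha0
    funext l
    have h1 : inner ℝ (∑ k, a k • indL ν (hEm k)) (indL ν (hEm l)) = a l * ν.real (E l) := by
      rw [sum_inner, Finset.sum_eq_single l]
      · rw [real_inner_smul_left, hii, Set.inter_self]
      · intro k _ hk
        rw [real_inner_smul_left, hii, (hEd hk).inter_eq]
        simp
      · simp
    rw [hz, inner_zero_left] at h1
    rcases mul_eq_zero.1 h1.symm with h2 | h2
    · exact h2
    · exact absurd ((measureReal_eq_zero_iff).1 h2) (hE0 l)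
  · rw [sum_inner, ← hu]
    refine Finset.sum_congr rfl fun k _ => ?_
    rw [real_inner_smul_left, real_inner_comm, inner_indL]
  · rw [sum_inner, ← hv]
    refine Finset.sum_congr rfl fun k _ => ?_
    rw [real_inner_smul_left, real_inner_comm, inner_indL]
  · intro B hB
    rw [sum_inner]
    refine Finset.sum_eq_zero fun k _ => ?_
    have hz : ν (E k ∩ B) = 0 :=
      measure_mono_null (Set.inter_subset_inter_left _ (hED k)) (inter_atm_null hD hna hB)
    rw [real_inner_smul_left, hii, measureReal_def, hz]
    simp
  · have h3 : ∀ k, indL ν (hEm k) =ᵐ[ν] Set.indicator (E k) fun _ => (1:ℝ) :=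
      fun k => indicatorConstLp_coeFn
    have h4 : ∀ k, (a k • indL ν (hEm k) : Lp ℝ 2 ν) =ᵐ[ν] a k • (indL ν (hEm k) : C → ℝ) :=
      fun k => Lp.coeFn_smul _ _
    rw [Fin.sum_univ_three]
    filter_upwards [h3 0, h3 1, h3 2, h4 0, h4 1, h4 2,
      Lp.coeFn_add (a 0 • indL ν (hEm 0) + a 1 • indL ν (hEm 1)) (a 2 • indL ν (hEm 2)),
      Lp.coeFn_add (a 0 • indL ν (hEm 0)) (a 1 • indL ν (hEm 1))]
      with x x0 x1 x2 y0 y1 y2 z1 z2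
    have hval : ((a 0 • indL ν (hEm 0) + a 1 • indL ν (hEm 1) + a 2 • indL ν (hEm 2) :
        Lp ℝ 2 ν) : C → ℝ) x = a 0 * (E 0).indicator (fun _ => (1:ℝ)) x +
        a 1 * (E 1).indicator (fun _ => (1:ℝ)) x + a 2 * (E 2).indicator (fun _ => (1:ℝ)) x := by
      rw [z1, Pi.add_apply, z2, Pi.add_apply, y0, y1, y2]
      simp only [Pi.smul_apply, smul_eq_mul, x0, x1, x2]
    rw [hval]
    have d01 : x ∈ E 0 → x ∉ E 1 := fun h h' =>
      Set.disjoint_left.1 (hEd (show (0 : Fin 3) ≠ 1 by decide)) h h'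
    have d02 : x ∈ E 0 → x ∉ E 2 := fun h h' =>
      Set.disjoint_left.1 (hEd (show (0 : Fin 3) ≠ 2 by decide)) h h'
    have d12 : x ∈ E 1 → x ∉ E 2 := fun h h' =>
      Set.disjoint_left.1 (hEd (show (1 : Fin 3) ≠ 2 by decide)) h h'
    refine ⟨?_, fun hx => ?_⟩
    · by_cases m0 : x ∈ E 0
      · simp [m0, d01 m0, d02 m0, haδ]
      · by_cases m1 : x ∈ E 1
        · simp [m0, m1, d12 m1, haδ]
        · by_cases m2 : x ∈ E 2
          · simp [m0, m1, m2, haδ]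
          · simp [m0, m1, m2, hδ.le]
    · have m0 : x ∉ E 0 := fun h => hx (hED 0 h)
      have m1 : x ∉ E 1 := fun h => hx (hED 1 h)
      have m2 : x ∉ E 2 := fun h => hx (hED 2 h)
      simp [m0, m1, m2]

/-- Allocations agreeing with `Λ₀` on utilities and atoms. -/
def fixZ (f : Fin n → Lp ℝ 2 ν) (Λ₀ : Fin n → WeakDual ℝ (Lp ℝ 2 ν)) :
    Set (Fin n → WeakDual ℝ (Lp ℝ 2 ν)) :=
  {Λ | ∀ i, Λ i (f i) = Λ₀ i (f i) ∧
    ∀ B (hB : IsAtm ν B), Λ i (indL ν hB.1) = Λ₀ i (indL ν hB.1)}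

lemma fixZ_closed (f : Fin n → Lp ℝ 2 ν) (Λ₀ : Fin n → WeakDual ℝ (Lp ℝ 2 ν)) :
    IsClosed (fixZ f Λ₀) := by
  unfold fixZ
  simp only [Set.ofPred_forall, Set.ofPred_and]
  refine isClosed_iInter fun i => IsClosed.inter ?_ ?_
  · exact isClosed_eq (cont_eval i _) continuous_const
  · exact isClosed_iInter fun B => isClosed_iInter fun hB =>
      isClosed_eq (cont_eval i _) continuous_const

/-- Allocations which are pure on atoms. -/
def atmZ (ν : Measure C) [IsFiniteMeasure ν] (n : ℕ) : Set (Fin n → WeakDual ℝ (Lp ℝ 2 ν)) :=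
  {Λ | ∀ i, ∀ B (hB : IsAtm ν B), Λ i (indL ν hB.1) = 0 ∨ Λ i (indL ν hB.1) = ν.real B}

lemma atmZ_closed : IsClosed (atmZ ν n) := by
  unfold atmZ
  simp only [Set.ofPred_forall, Set.ofPred_or]
  exact isClosed_iInter fun i => isClosed_iInter fun B => isClosed_iInter fun hB =>
      (isClosed_eq (cont_eval i _) continuous_const).union
        (isClosed_eq (cont_eval i _) continuous_const)

lemma pure_of_extreme (f : Fin n → Lp ℝ 2 ν) (Λ₀ : Fin n → WeakDual ℝ (Lp ℝ 2 ν))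
    (hΛ₀ : Λ₀ ∈ atmZ ν n) (Φ : Fin n → Lp ℝ 2 ν) (hΦ : wkMap Φ ∈ feasZ ν n ∩ fixZ f Λ₀)
    (hext : ∀ Ψ, wkMap (Φ + Ψ) ∈ feasZ ν n ∩ fixZ f Λ₀ →
      wkMap (Φ + (-1 : ℝ) • Ψ) ∈ feasZ ν n ∩ fixZ f Λ₀ → Ψ = 0)
    (i j : Fin n) (hij : i ≠ j) (δ : ℝ) (hδ : 0 < δ) :
    ν {x | δ < Φ i x ∧ δ < Φ j x} = 0 := by
  set D : Set C := {x | δ < Φ i x ∧ δ < Φ j x} with hDdef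
  have hD : MeasurableSet D :=
    (measurableSet_lt measurable_const (Lp.stronglyMeasurable (Φ i)).measurable).inter
      (measurableSet_lt measurable_const (Lp.stronglyMeasurable (Φ j)).measurable)
  by_contra h0
  have hfe := (feas_iff Φ).1 hΦ.1
  have hna : ∀ B ⊆ D, ¬ IsAtm ν B := by
    intro B hBD hB
    have hpos : 0 < ν.real B := by
      rw [measureReal_def]
      exact ENNReal.toReal_pos hB.2.1 (measure_ne_top _ _)
    have hval : ∀ k, (∀ x ∈ B, δ < Φ k x) → ∫ x in B, Φ k x ∂ν = ν.real B := by
      intro k hk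
      have h1 : wkMap Φ k (indL ν hB.1) = 0 ∨ wkMap Φ k (indL ν hB.1) = ν.real B := by
        rw [(hΦ.2 k).2 B hB]
        exact hΛ₀ k B hB
      rw [wkMap_apply, inner_indL] at h1
      refine h1.resolve_left ?_
      have h2 : ∫ x in B, δ ∂ν ≤ ∫ x in B, Φ k x ∂ν :=
        setIntegral_mono_on (integrable_const _).integrableOn (L2_int _).integrableOn hB.1
          fun x hx => (hk x hx).le
      rw [setIntegral_const, smul_eq_mul] at h2
      have : 0 < ν.real B * δ := mul_pos hpos hδ
      linarith
    have hi := hval i fun x hx => (hBD hx).1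
    have hj := hval j fun x hx => (hBD hx).2
    obtain ⟨hnn, hsum⟩ := hΦ.1 B hB.1
    simp only [wkMap_apply, inner_indL] at hnn hsum
    have : ∑ k ∈ {i, j}, ∫ x in B, Φ k x ∂ν ≤ ∑ k, ∫ x in B, Φ k x ∂ν :=
      Finset.sum_le_sum_of_subset_of_nonneg (Finset.subset_univ _) fun k _ _ => hnn k
    rw [Finset.sum_pair hij, hi, hj, hsum] at this
    linarith
  obtain ⟨h, hh0, hf, hg, hat, hb⟩ := exists_pert hD h0 hna (f i) (f j) δ hδ
  let c : Fin n → ℝ := fun k => if k = i then 1 else if k = j then -1 else 0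
  have hcs : ∑ k, c k = 0 := by
    have : ∀ k, c k = (if k = i then (1:ℝ) else 0) - (if k = j then (1:ℝ) else 0) := by
      intro k
      simp only [c]
      by_cases h1 : k = i
      · subst h1; simp [hij]
      · simp only [h1, if_false]; split_ifs <;> norm_num
    simp [this, Finset.sum_sub_distrib]
  have hmem : ∀ s : ℝ, |s| ≤ 1 → wkMap (Φ + s • fun k => c k • h) ∈ feasZ ν n ∩ fixZ f Λ₀ := by
    intro s hs
    constructor
    · rw [feas_iff]
      have hco : ∀ k, ∀ᵐ x ∂ν, (Φ + s • fun k => c k • h) k x = Φ k x + s * (c k * h x) := by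
        intro k
        have e1 := Lp.coeFn_add (Φ k) (s • (c k • h))
        have e2 := Lp.coeFn_smul s (c k • h)
        have e3 := Lp.coeFn_smul (c k) h
        filter_upwards [e1, e2, e3] with x e1 e2 e3
        rw [Pi.add_apply, Pi.smul_apply, e1, Pi.add_apply, e2, Pi.smul_apply, e3]
        simp
      constructor
      · intro k
        filter_upwards [hco k, hb, hfe.1 k] with x h1 h2 h3
        rw [h1]
        by_cases hx : x ∈ D
        · have hsh : |s * h x| ≤ δ := by
            rw [abs_mul]
            calc |s| * |h x| ≤ 1 * δ := mul_le_mul hs h2.1 (abs_nonneg _) zero_le_one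
              _ = δ := one_mul _
          have hsh' := abs_le.1 hsh
          by_cases hki : k = i
          · subst hki
            have := hx.1
            simp only [c, if_true, one_mul]
            linarith
          · by_cases hkj : k = j
            · subst hkj
              have := hx.2
              simp only [c, hki, if_true, if_false]
              linarith
            · simp only [c, hki, hkj, if_false]
              linarith
        · rw [h2.2 hx]; simpa using h3
      · filter_upwards [ae_all_iff.2 hco, hfe.2] with x h1 h2
        rw [Finset.sum_congr rfl fun k _ => h1 k, Finset.sum_add_distrib, h2, ← Finset.mul_sum,
          ← Finset.sum_mul, hcs]
        simp
    · intro k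
      have h1 := hΦ.2 k
      simp only [wkMap_apply] at h1 ⊢
      constructor
      · rw [← h1.1, Pi.add_apply, Pi.smul_apply, inner_add_left, real_inner_smul_left,
          real_inner_smul_left]
        by_cases hki : k = i
        · subst hki; rw [hf]; simp
        · by_cases hkj : k = j
          · subst hkj; rw [hg]; simp
          · simp [c, hki, hkj]
      · intro B hB
        rw [← h1.2 B hB, Pi.add_apply, Pi.smul_apply, inner_add_left, real_inner_smul_left,
          real_inner_smul_left, hat B hB]
        simp
  have h1 := hmem 1 (by simp)
  have h2 := hmem (-1) (by simp)
  rw [one_smul] at h1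
  have h3 := congrFun (hext _ h1 h2) i
  simp [c] at h3
  exact hh0 h3

lemma part_sum (A : Fin n → Set C) (hA : IsMPartition A) (x : C) :
    ∑ i, (A i).indicator (fun _ => (1:ℝ)) x = 1 := by
  have hx : x ∈ ⋃ i, A i := by rw [hA.2.2]; trivial
  obtain ⟨i, hi⟩ := Set.mem_iUnion.1 hx
  rw [Finset.sum_eq_single i]
  · simp [hi]
  · intro j _ hj
    exact Set.indicator_of_notMem (fun h => Set.disjoint_left.1 (hA.2.1 hj) h hi) _
  · simp

lemma part_mem (A : Fin n → Set C) (hA : IsMPartition A) :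
    wkMap (fun i => indL ν (hA.1 i)) ∈ feasZ ν n ∩ atmZ ν n := by
  have h3 : ∀ i, indL ν (hA.1 i) =ᵐ[ν] Set.indicator (A i) fun _ => (1:ℝ) :=
    fun i => indicatorConstLp_coeFn
  constructor
  · rw [feas_iff]
    constructor
    · intro i
      filter_upwards [h3 i] with x hx
      rw [hx]
      exact Set.indicator_nonneg (fun _ _ => zero_le_one) x
    · filter_upwards [ae_all_iff.2 h3] with x hx
      rw [Finset.sum_congr rfl fun i _ => hx i]
      exact part_sum A hA x
  · intro i B hB
    rw [wkMap_apply, inner_indL, integral_congr_ae (ae_restrict_of_ae (h3 i)),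
      setIntegral_indicator (hA.1 i), setIntegral_const, smul_eq_mul, mul_one]
    rcases hB.2.2 (B ∩ A i) Set.inter_subset_left (hB.1.inter (hA.1 i)) with h | h
    · left; rw [measureReal_def, h]; rfl
    · right
      rw [Set.sdiff_self_inter] at h
      rw [measureReal_def, measureReal_def, ← measure_inter_add_sdiff B (hA.1 i), h, add_zero]

/-- From a pure allocation to a partition. -/
lemma exists_part (Φ : Fin n → Lp ℝ 2 ν) (hn : 0 < n) (hΦ : wkMap Φ ∈ feasZ ν n)
    (hp : ∀ i j, i ≠ j → ∀ δ : ℝ, 0 < δ → ν {x | δ < Φ i x ∧ δ < Φ j x} = 0) :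
    ∃ A : Fin n → Set C, ∃ hA : IsMPartition A, Φ = fun i => indL ν (hA.1 i) := by
  have hdis : ∀ i j, i ≠ j → ∀ᵐ x ∂ν, ¬ (0 < Φ i x ∧ 0 < Φ j x) := by
    intro i j hij
    have h1 : ∀ m : ℕ, ∀ᵐ x ∂ν, ¬ (1 / ((m : ℝ) + 1) < Φ i x ∧ 1 / ((m : ℝ) + 1) < Φ j x) := by
      intro m
      have := hp i j hij (1 / ((m : ℝ) + 1)) (by positivity)
      rw [ae_iff]
      simpa using this
    filter_upwards [ae_all_iff.2 h1] with x hx hpos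
    obtain ⟨m, hm⟩ := exists_nat_one_div_lt (lt_min hpos.1 hpos.2)
    exact hx m (lt_min_iff.1 hm)
  let z : Fin n := ⟨0, hn⟩
  let P : Fin n → Set C := fun i => {x | 0 < Φ i x}
  have hP : ∀ i, MeasurableSet (P i) := fun i =>
    measurableSet_lt measurable_const (Lp.stronglyMeasurable (Φ i)).measurable
  let U : Set C := ⋃ i, P i
  have hU : MeasurableSet U := MeasurableSet.iUnion hP
  let A : Fin n → Set C := fun i =>
    (P i \ ⋃ j, ⋃ (_ : j < i), P j) ∪ {x | i = z ∧ x ∉ U}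
  have hA : IsMPartition A := by
    refine ⟨fun i => ?_, ?_, ?_⟩
    · refine MeasurableSet.union ((hP i).diff (MeasurableSet.iUnion fun j =>
        MeasurableSet.iUnion fun _ => hP j)) ?_
      by_cases hi : i = z
      · have he : {x | i = z ∧ x ∉ U} = Uᶜ := by
          ext x
          exact ⟨fun h => h.2, fun h => ⟨hi, h⟩⟩
        rw [he]
        exact hU.compl
      · simp [hi]
    · have key : ∀ i j, i < j → Disjoint (A i) (A j) := by
        intro i j hij
        rw [Set.disjoint_left]
        rintro x (⟨h1, h2⟩ | ⟨h1, h2⟩) (⟨h3, h4⟩ | ⟨h3, h4⟩)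
        · exact h4 (Set.mem_iUnion₂.2 ⟨i, hij, h1⟩)
        · exact h4 (Set.mem_iUnion.2 ⟨i, h1⟩)
        · exact h2 (Set.mem_iUnion.2 ⟨j, h3⟩)
        · exact hij.ne (h1.trans h3.symm)
      intro i j hij
      rcases lt_or_gt_of_ne hij with h | h
      · exact key i j h
      · exact (key j i h).symm
    · refine Set.eq_univ_of_forall fun x => ?_
      by_cases hx : x ∈ U
      · obtain ⟨i, hi, hmin⟩ := WellFounded.has_min (wellFounded_lt (α := Fin n)) {i | x ∈ P i}
          (Set.mem_iUnion.1 hx)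
        refine Set.mem_iUnion.2 ⟨i, Or.inl ⟨hi, fun h => ?_⟩⟩
        obtain ⟨j, hj, hxj⟩ := Set.mem_iUnion₂.1 h
        exact hmin j hxj hj
      · exact Set.mem_iUnion.2 ⟨z, Or.inr ⟨rfl, hx⟩⟩
  refine ⟨A, hA, ?_⟩
  obtain ⟨hnn, hsum⟩ := (feas_iff Φ).1 hΦ
  funext i
  apply Lp.ext
  have h3 : indL ν (hA.1 i) =ᵐ[ν] Set.indicator (A i) fun _ => (1:ℝ) := indicatorConstLp_coeFn
  have hd : ∀ᵐ x ∂ν, ∀ i j, i ≠ j → ¬ (0 < Φ i x ∧ 0 < Φ j x) := by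
    simp only [ae_all_iff]
    exact hdis
  filter_upwards [h3, hd, ae_all_iff.2 hnn, hsum] with x h3 hd hnn hsum
  rw [h3]
  have hex : ∃ k, 0 < Φ k x := by
    by_contra hcon
    push Not at hcon
    have : ∑ i, Φ i x ≤ 0 := Finset.sum_nonpos fun i _ => hcon i
    linarith
  obtain ⟨k, hk⟩ := hex
  have hz : ∀ j, j ≠ k → Φ j x = 0 := fun j hj =>
    le_antisymm (not_lt.1 fun h => hd j k hj ⟨h, hk⟩) (hnn j)
  have hk1 : Φ k x = 1 := by
    rw [← hsum, Finset.sum_eq_single k (fun j _ hj => hz j hj) (by simp)]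
  have hxU : x ∈ U := Set.mem_iUnion.2 ⟨k, hk⟩
  by_cases hik : i = k
  · subst hik
    rw [hk1, Set.indicator_of_mem]
    refine Or.inl ⟨hk, fun h => ?_⟩
    obtain ⟨j, hj, hxj⟩ := Set.mem_iUnion₂.1 h
    exact hd j i hj.ne ⟨hxj, hk⟩
  · rw [hz i hik, Set.indicator_of_notMem]
    rintro (⟨h1, _⟩ | ⟨_, h2⟩)
    · exact hd i k hik ⟨h1, hk⟩
    · exact h2 hxU

end L2

/-- The supremum defining `v^α` is attained by some measurable partition. -/
theorem vopt_attained {C : Type*} [MeasurableSpace C] {n : ℕ} (hn : 2 ≤ n)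
    (μ : Fin n → Measure C) [∀ i, IsFiniteMeasure (μ i)] (hna : ∀ i, NoAtoms (μ i))
    (α : Fin n → ℝ) (hpos : ∀ i, 0 < α i) (hsum : ∑ i, α i = 1) :
    ∃ A : Fin n → Set C, IsMPartition A ∧
      (⨅ i, (μ i (A i)).toReal / α i) = vopt μ α := by
  have hn0 : 0 < n := by omega
  have : Nonempty (Fin n) := ⟨⟨0, hn0⟩⟩
  let ν : Measure C := ∑ i, μ i
  have hle : ∀ i, μ i ≤ ν := fun i =>
    Finset.single_le_sum (f := μ) (fun j _ => Measure.zero_le _) (Finset.mem_univ i)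
  have hfm : ∀ i, MemLp (fun x => ((μ i).rnDeriv ν x).toReal) 2 ν := by
    intro i
    refine MemLp.of_bound (Measure.measurable_rnDeriv _ _).ennreal_toReal.aestronglyMeasurable 1 ?_
    filter_upwards [Measure.rnDeriv_le_one_of_le (hle i)] with x hx
    rw [Real.norm_eq_abs, abs_of_nonneg ENNReal.toReal_nonneg]
    exact ENNReal.toReal_le_of_le_ofReal zero_le_one (by simpa using hx)
  let f : Fin n → Lp ℝ 2 ν := fun i => (hfm i).toLp
  have hval : ∀ (A : Fin n → Set C) (hA : IsMPartition A) (i : Fin n),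
      wkMap (fun i => indL ν (hA.1 i)) i (f i) = (μ i (A i)).toReal := by
    intro A hA i
    rw [wkMap_apply, real_inner_comm, inner_indL,
      integral_congr_ae (ae_restrict_of_ae (hfm i).coeFn_toLp),
      Measure.setIntegral_toReal_rnDeriv (hle i).absolutelyContinuous, measureReal_def]
  let F : (Fin n → WeakDual ℝ (Lp ℝ 2 ν)) → ℝ := fun Λ => ⨅ i, Λ i (f i) / α i
  have hF : Continuous F := by
    have : F = fun Λ => Finset.univ.inf' Finset.univ_nonempty fun i => Λ i (f i) / α i := by
      funext Λ
      exact (Finset.inf'_univ_eq_ciInf _).symm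
    rw [this]
    exact Continuous.finset_inf'_apply _ fun i _ => (cont_eval i _).div_const _
  let A₀ : Fin n → Set C := fun i => {_x | i = ⟨0, hn0⟩}
  have hA₀ : IsMPartition A₀ := by
    refine ⟨fun i => MeasurableSet.const _, ?_, ?_⟩
    · intro i j hij
      refine Set.disjoint_left.2 fun x hi hj => hij ?_
      exact Eq.trans hi (Eq.symm hj)
    · exact Set.eq_univ_of_forall fun x => Set.mem_iUnion.2 ⟨⟨0, hn0⟩, rfl⟩
  obtain ⟨Λ₀, hΛ₀, hmax⟩ := (feas_compact (atmZ ν n) atmZ_closed).exists_isMaxOn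
    ⟨_, part_mem A₀ hA₀⟩ hF.continuousOn
  obtain ⟨Φ, hΦ, hext⟩ := wk_extreme _ (feas_compact (fixZ f Λ₀) (fixZ_closed f Λ₀))
    ⟨Λ₀, hΛ₀.1, fun i => ⟨rfl, fun _ _ => rfl⟩⟩
  obtain ⟨A, hA, rfl⟩ := exists_part Φ hn0 hΦ.1
    (pure_of_extreme f Λ₀ hΛ₀.2 Φ hΦ hext)
  refine ⟨A, hA, ?_⟩
  have hFA : (⨅ i, (μ i (A i)).toReal / α i) = F Λ₀ := by
    simp only [F]
    congr 1
    funext i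
    rw [← hval A hA i, (hΦ.2 i).1]
  symm
  refine IsGreatest.csSup_eq ⟨⟨A, hA, rfl⟩, ?_⟩
  rintro r ⟨B, hB, rfl⟩
  rw [hFA]
  have hB' : (⨅ i, (μ i (B i)).toReal / α i) = F (wkMap fun i => indL ν (hB.1 i)) := by
    simp only [F]
    congr 1
    funext i
    rw [← hval B hB i]
  rw [hB']
  exact hmax (part_mem B hB)
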